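/- Let m be a universal semimeasure with a fixed approximation (m_t) from below. For computable functions f : ℕ → ℕ and g : List Bool × ℕ → ℕ, define e_{f,g}(x) = |x|/(log |x|)⁵ if for every t either m_{f(t)}(t) ≤ 6·log|x| / |x| or m_{g(x,t)}(x) ≥ 2·m_t(x), and e_{f,g}(x) = 1 otherwise (here m_s(t) denotes m_s at the string of t zeros). Then there exist a constant c > 0 and a computable f such that for every computable g, the function c · e_{f,g} is an upper semicomputable sumtest for m; in particular e_{f,g} is upper semicomputable and ∑' x, m(x) · e_{f,g}(x) ≤ 1/c. -/

import Mathlib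

open scoped ENNReal NNReal

/-- Interpret a rational approximation value as an extended nonnegative real. -/
noncomputable def qval (q : ℚ) : ℝ≥0∞ := ENNReal.ofReal q

/-- Interpret a value in `ℚ≥0 ∪ {∞}` (with nonnegativity required separately)
as an extended nonnegative real; `none` stands for `∞`. -/
noncomputable def qtval (q : Option ℚ) : ℝ≥0∞ := q.elim ⊤ (fun a => ENNReal.ofReal a)

/-- A (discrete) semimeasure on bitstrings. -/
def IsSemimeasure (P : List Bool → ℝ≥0∞) : Prop := ∑' x, P x ≤ 1

/-- `Ps` is a computable approximation of `P` from below (by nonnegative rationals,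
nondecreasing in the stage). -/
def IsApproxFromBelow (P : List Bool → ℝ≥0∞) (Ps : List Bool → ℕ → ℚ) : Prop :=
  Computable (fun p : List Bool × ℕ => Ps p.1 p.2) ∧
  (∀ x s, 0 ≤ Ps x s) ∧
  (∀ x, Monotone fun s => Ps x s) ∧
  (∀ x, P x = ⨆ s, qval (Ps x s))

/-- `P` is lower semicomputable. -/
def LowerSemicomputable (P : List Bool → ℝ≥0∞) : Prop := ∃ Ps, IsApproxFromBelow P Ps

/-- `es` is a computable approximation of `e` from above (by values in `ℚ≥0 ∪ {∞}`,
nonincreasing in the stage). -/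
def IsApproxFromAbove (e : List Bool → ℝ≥0∞) (es : List Bool → ℕ → Option ℚ) : Prop :=
  Computable (fun p : List Bool × ℕ => es p.1 p.2) ∧
  (∀ x s, ∀ a ∈ es x s, (0:ℚ) ≤ a) ∧
  (∀ x, Antitone fun s => qtval (es x s)) ∧
  (∀ x, e x = ⨅ s, qtval (es x s))

/-- `e` is upper semicomputable. -/
def UpperSemicomputable (e : List Bool → ℝ≥0∞) : Prop := ∃ es, IsApproxFromAbove e es

/-- `e` is a sumtest for the semimeasure `P`. -/
def IsSumtest (P e : List Bool → ℝ≥0∞) : Prop := ∑' x, P x * e x ≤ 1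

/-- `m` is a universal (lower semicomputable) semimeasure. -/
def IsUniversalSemimeasure (m : List Bool → ℝ≥0∞) : Prop :=
  IsSemimeasure m ∧ LowerSemicomputable m ∧
  ∀ P, IsSemimeasure P → LowerSemicomputable P → ∃ c : ℝ≥0, 0 < c ∧ ∀ x, P x ≤ c * m x

/-- A conditional semimeasure `m(·|·)`. -/
def IsCondSemimeasure (m : List Bool → ℕ → ℝ≥0∞) : Prop := ∀ s, ∑' x, m x s ≤ 1

/-- `ms` is a computable approximation from below of the conditional semimeasure `m`:
`ms t x s` approximates `m(x|s)`, nondecreasing in the stage `t`. -/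
def IsCondApproxFromBelow (m : List Bool → ℕ → ℝ≥0∞) (ms : ℕ → List Bool → ℕ → ℚ) : Prop :=
  Computable (fun p : ℕ × List Bool × ℕ => ms p.1 p.2.1 p.2.2) ∧
  (∀ t x s, 0 ≤ ms t x s) ∧
  (∀ x s, Monotone fun t => ms t x s) ∧
  (∀ x s, m x s = ⨆ t, qval (ms t x s))

/-- The conditional semimeasure `m` is lower semicomputable (jointly). -/
def CondLowerSemicomputable (m : List Bool → ℕ → ℝ≥0∞) : Prop :=
  ∃ ms, IsCondApproxFromBelow m ms

/-- `m(·|·)` is a universal lower semicomputable conditional semimeasure. -/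
def IsUniversalCondSemimeasure (m : List Bool → ℕ → ℝ≥0∞) : Prop :=
  IsCondSemimeasure m ∧ CondLowerSemicomputable m ∧
  ∀ m', IsCondSemimeasure m' → CondLowerSemicomputable m' →
    ∃ c : ℝ≥0, 0 < c ∧ ∀ x s, m' x s ≤ c * m x s

/-- The string consisting of `t` zeros, representing the natural number `t`. -/
def zeros (t : ℕ) : List Bool := List.replicate t false

open scoped Classical in
/-- The test `e_{f,g}`: it equals `|x|/(log |x|)⁵` if for every `t` either
`m_{f(t)}(t) ≤ 6 log|x| / |x|` or `m_{g(x,t)}(x) ≥ 2 m_t(x)`, and `1` otherwise. -/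
noncomputable def etest (mt : List Bool → ℕ → ℚ) (f : ℕ → ℕ) (g : List Bool × ℕ → ℕ)
    (x : List Bool) : ℝ≥0∞ :=
  if ∀ t : ℕ,
      qval (mt (zeros t) (f t)) ≤
          ENNReal.ofReal (6 * Real.logb 2 x.length / x.length) ∨
      2 * qval (mt x t) ≤ qval (mt x (g (x, t)))
  then ENNReal.ofReal (x.length / (Real.logb 2 x.length) ^ 5)
  else 1

section Computability

open Encodable Denumerable

attribute [fun_prop] Computable
attribute [fun_prop] Computable.id Computable.const Computable.comp Computable.fst Computable.snd

section
variable {α β γ : Type*} [Primcodable α] [Primcodable β] [Primcodable γ]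

@[fun_prop]
theorem Computable.prodMk {f : α → β} {g : α → γ} (hf : Computable f) (hg : Computable g) :
    Computable fun a => (f a, g a) := hf.pair hg

@[fun_prop]
theorem Computable.natAdd {f g : α → ℕ} (hf : Computable f) (hg : Computable g) :
    Computable fun a => f a + g a := Primrec.nat_add.to_comp.comp hf hg

@[fun_prop]
theorem Computable.natSub {f g : α → ℕ} (hf : Computable f) (hg : Computable g) :
    Computable fun a => f a - g a := Primrec.nat_sub.to_comp.comp hf hg

@[fun_prop]
theorem Computable.natMul {f g : α → ℕ} (hf : Computable f) (hg : Computable g) :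
    Computable fun a => f a * g a := Primrec.nat_mul.to_comp.comp hf hg

@[fun_prop]
theorem Computable.natDiv {f g : α → ℕ} (hf : Computable f) (hg : Computable g) :
    Computable fun a => f a / g a := Primrec.nat_div.to_comp.comp hf hg

@[fun_prop]
theorem Computable.natMod {f g : α → ℕ} (hf : Computable f) (hg : Computable g) :
    Computable fun a => f a % g a := Primrec.nat_mod.to_comp.comp hf hg

@[fun_prop]
theorem Computable.natPow {f g : α → ℕ} (hf : Computable f) (hg : Computable g) :
    Computable fun a => f a ^ g a :=
  (Primrec₂.unpaired'.1 Nat.Primrec.pow).to_comp.comp hf hg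

@[fun_prop]
theorem Computable.natBle {f g : α → ℕ} (hf : Computable f) (hg : Computable g) :
    Computable fun a => Nat.ble (f a) (g a) :=
  (Primrec.nat_le.decide.to_comp.comp hf hg).of_eq fun a => by
    rw [Bool.eq_iff_iff]; simp

@[fun_prop]
theorem Computable.bEq [DecidableEq β] {f g : α → β} (hf : Computable f) (hg : Computable g) :
    Computable fun a => f a == g a :=
  Primrec.beq.to_comp.comp hf hg

@[fun_prop]
theorem Computable.boolAnd {f g : α → Bool} (hf : Computable f) (hg : Computable g) :
    Computable fun a => f a && g a := Primrec.and.to_comp.comp hf hg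

@[fun_prop]
theorem Computable.boolOr {f g : α → Bool} (hf : Computable f) (hg : Computable g) :
    Computable fun a => f a || g a := Primrec.or.to_comp.comp hf hg

@[fun_prop]
theorem Computable.boolNot {f : α → Bool} (hf : Computable f) :
    Computable fun a => !f a := Primrec.not.to_comp.comp hf

@[fun_prop]
theorem Computable.bifCond {c : α → Bool} {f g : α → β} (hc : Computable c) (hf : Computable f)
    (hg : Computable g) : Computable fun a => bif c a then f a else g a := hc.cond hf hg

@[fun_prop]
theorem Computable.natRec {f : α → ℕ} {g : α → β} {h : α → ℕ → β → β} (hf : Computable f)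
    (hg : Computable g) (hh : Computable fun p : α × ℕ × β => h p.1 p.2.1 p.2.2) :
    Computable fun a => Nat.rec (motive := fun _ => β) (g a) (h a) (f a) :=
  Computable.nat_rec hf hg (h := fun a p => h a p.1 p.2) hh

@[fun_prop]
theorem Computable.listLength {f : α → List β} (hf : Computable f) :
    Computable fun a => (f a).length := Computable.list_length.comp hf

/-- Unbounded search for a witness of a decidable property of naturals is computable. -/
theorem Computable.exists_least {p : α → ℕ → Bool} (hp : Computable fun x : α × ℕ => p x.1 x.2)
    (hex : ∀ a, ∃ n, p a n = true) :
    ∃ f : α → ℕ, Computable f ∧ ∀ a, p a (f a) = true ∧ ∀ n, p a n = true → f a ≤ n :=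
  ⟨_, Computable.find (P := fun a n => p a n = true)
    (Computable.computablePred (by simpa using hp)) hex,
    fun a => ⟨Nat.find_spec (hex a), fun _ h => Nat.find_min' _ h⟩⟩

end

theorem exists_monotone_enumeration_ratCode :
    ∃ c : ℚ → ℕ, (∀ q : ℚ, c q = Nat.pair (encode q.num) q.den) ∧
      (∀ n, ∀ q, c (ofNat ℚ n) < c q → c (ofNat ℚ (n + 1)) ≤ c q) ∧
      ∀ n, c (ofNat ℚ n) < c (ofNat ℚ (n + 1)) := by
  let := @decidableRangeEncode ℚ Rat.instEncodable
  let : Infinite (Set.range (@encode ℚ Rat.instEncodable)) :=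
    Infinite.of_injective _ (Equiv.ofInjective _ (@encode_injective ℚ Rat.instEncodable)).injective
  have key : ∀ n, @encode ℚ Rat.instEncodable (ofNat ℚ n) =
      (Nat.Subtype.ofNat (Set.range (@encode ℚ Rat.instEncodable)) n : ℕ) := by
    intro n
    let := Nat.Subtype.denumerable (Set.range (@encode ℚ Rat.instEncodable))
    have h : ofNat ℚ n = (@equivRangeEncode ℚ Rat.instEncodable).symm
        (Nat.Subtype.ofNat (Set.range (@encode ℚ Rat.instEncodable)) n) := by
      exact (ofEquiv_ofNat (Set.range (@encode ℚ Rat.instEncodable))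
        (@equivRangeEncode ℚ Rat.instEncodable) n)
    rw [h]
    exact congrArg Subtype.val
      ((@equivRangeEncode ℚ Rat.instEncodable).apply_symm_apply _)
  refine ⟨@encode ℚ Rat.instEncodable, fun q => rfl, fun n q h => ?_, fun n => ?_⟩
  · simp only [key] at h ⊢
    exact Nat.Subtype.succ_le_of_lt (x := ⟨_, Set.mem_range_self q⟩) h
  · simp only [key]
    exact Nat.Subtype.lt_succ_self _

theorem Int.encode_ofNat (a : ℕ) : encode (a : ℤ) = 2 * a := by
  show Equiv.intEquivNat _ = _
  simp [Equiv.intEquivNat, Equiv.intEquivNatSumNat, Equiv.natSumNatEquivNat_apply]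
  rfl

theorem Int.encode_negSucc (a : ℕ) : encode (Int.negSucc a) = 2 * a + 1 := by
  show Equiv.intEquivNat _ = _
  simp [Equiv.intEquivNat, Equiv.intEquivNatSumNat, Equiv.natSumNatEquivNat_apply]

theorem Int.natAbs_eq_of_encode (z : ℤ) : z.natAbs = (encode z + 1) / 2 := by
  cases z with
  | ofNat a => have := Int.encode_ofNat a; simp at this ⊢; omega
  | negSucc a => have := Int.encode_negSucc a; simp [this]; omega

theorem primrecRel_nat_dvd : PrimrecRel ((· ∣ ·) : ℕ → ℕ → Prop) :=
  (Primrec.eq.comp (Primrec.nat_mod.comp Primrec.snd Primrec.fst) (Primrec.const 0)).of_eq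
    fun _ => (Nat.dvd_iff_mod_eq_zero).symm

theorem Nat.coprime_iff_forall_lt (a b : ℕ) :
    Nat.Coprime a b ↔ ∀ k < a + b + 1, k ∣ a ∧ k ∣ b → k = 1 := by
  refine ⟨fun h k _ hk => Nat.eq_one_of_dvd_coprimes h hk.1 hk.2, fun h => ?_⟩
  refine h _ ?_ ⟨Nat.gcd_dvd_left a b, Nat.gcd_dvd_right a b⟩
  rcases Nat.eq_zero_or_pos a with rfl | ha
  · simp
  · have := Nat.gcd_le_left b ha
    omega

theorem primrecRel_nat_coprime : PrimrecRel Nat.Coprime := by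
  have h : PrimrecRel fun k y : ℕ => k ∣ y.unpair.1 ∧ k ∣ y.unpair.2 → k = 1 :=
    (((primrecRel_nat_dvd.comp Primrec.fst (Primrec.fst.comp (Primrec.unpair.comp Primrec.snd))).and
      (primrecRel_nat_dvd.comp Primrec.fst
        (Primrec.snd.comp (Primrec.unpair.comp Primrec.snd)))).not.or
      (Primrec.eq.comp Primrec.fst (Primrec.const 1))).of_eq fun _ => by tauto
  have h2 := h.forall_lt.comp (f := fun p : ℕ × ℕ => p.1 + p.2 + 1)
    (Primrec.succ.comp (Primrec.nat_add.comp Primrec.fst Primrec.snd))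
    (Primrec₂.natPair.comp Primrec.fst Primrec.snd)
  exact h2.of_eq fun p => by simp [Nat.coprime_iff_forall_lt p.1 p.2]

/-- The code `n` of a rational is turned computably into the pair of codes of its numerator and
denominator. -/
theorem Rat.computable_pair_encode_num_den :
    Computable fun q : ℚ => Nat.pair (encode q.num) q.den := by
  obtain ⟨c, hc, hle, hlt⟩ := exists_monotone_enumeration_ratCode
  let R : ℕ → Prop := fun y => 0 < y.unpair.2 ∧ Nat.Coprime ((y.unpair.1 + 1) / 2) y.unpair.2
  have hR : ∀ y, R y ↔ ∃ q, c q = y := by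
    intro y
    constructor
    · rintro ⟨h0, h1⟩
      refine ⟨⟨ofNat ℤ y.unpair.1, y.unpair.2, h0.ne', ?_⟩, ?_⟩
      · have := Int.natAbs_eq_of_encode (ofNat ℤ y.unpair.1)
        rw [encode_ofNat] at this
        rwa [this]
      · rw [hc]
        show Nat.pair (encode (ofNat ℤ y.unpair.1)) y.unpair.2 = y
        rw [encode_ofNat, Nat.pair_unpair]
    · rintro ⟨q, rfl⟩
      simp only [R, hc, Nat.unpair_pair]
      refine ⟨q.pos, ?_⟩
      have := q.reduced
      rwa [Int.natAbs_eq_of_encode] at this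
  have hRp : PrimrecPred R :=
    (Primrec.nat_lt.comp (Primrec.const 0) (Primrec.snd.comp Primrec.unpair)).and
      (primrecRel_nat_coprime.comp
        (Primrec.nat_div.comp (Primrec.succ.comp (Primrec.fst.comp Primrec.unpair))
          (Primrec.const 2)) (Primrec.snd.comp Primrec.unpair))
  have hmono : StrictMono fun n => c (ofNat ℚ n) := strictMono_nat_of_lt_succ hlt
  have hex : ∀ m : ℕ, ∃ y, R y ∧ m < y := fun m =>
    ⟨c (ofNat ℚ (m + 1)), (hR _).2 ⟨_, rfl⟩, hmono.id_le (m + 1)⟩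
  classical
  have hnext : Computable fun m => Nat.find (hex m) :=
    Computable.find (P := fun m y => R y ∧ m < y)
      (PrimrecPred.computablePred ((hRp.comp Primrec.snd).and
        (Primrec.nat_lt.comp Primrec.fst Primrec.snd))) hex
  have hseq : Computable fun n : ℕ => c (ofNat ℚ n) := by
    refine (Computable.nat_rec (f := fun n : ℕ => n) (g := fun _ => c (ofNat ℚ 0))
      (h := fun _ p => Nat.find (hex p.2)) Computable.id (Computable.const _)
      (hnext.comp (Computable.snd.comp Computable.snd)).to₂).of_eq fun n => ?_
    induction n with
    | zero => rfl
    | succ n ih =>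
      simp only at ih ⊢
      rw [ih]
      refine le_antisymm (Nat.find_min' _ ⟨(hR _).2 ⟨_, rfl⟩, hlt n⟩) ?_
      have h := Nat.find_spec (hex (c (ofNat ℚ n)))
      obtain ⟨q, hq⟩ := (hR _).1 h.1
      rw [← hq] at h ⊢
      exact hle n q h.2
  exact (hseq.comp Computable.encode).of_eq fun q => by rw [ofNat_encode, hc]

theorem Int.toNat_eq_of_encode (z : ℤ) :
    z.toNat = if encode z % 2 = 0 then encode z / 2 else 0 := by
  cases z with
  | ofNat a => have := Int.encode_ofNat a; simp at this ⊢; simp [this]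
  | negSucc a => have := Int.encode_negSucc a; simp [this]

theorem Int.nonneg_iff_encode (z : ℤ) : 0 ≤ z ↔ encode z % 2 = 0 := by
  cases z with
  | ofNat a => have := Int.encode_ofNat a; simp at this ⊢; simp [this]
  | negSucc a => have := Int.encode_negSucc a; simp [this]

theorem Rat.computable_encode_num : Computable fun q : ℚ => encode q.num :=
  (Computable.fst.comp (Computable.unpair.comp Rat.computable_pair_encode_num_den)).of_eq
    fun q => by simp

theorem Rat.computable_den : Computable fun q : ℚ => q.den :=
  (Computable.snd.comp (Computable.unpair.comp Rat.computable_pair_encode_num_den)).of_eq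
    fun q => by simp

theorem Rat.computable_num_toNat : Computable fun q : ℚ => q.num.toNat := by
  have h : Primrec fun n : ℕ => if n % 2 = 0 then n / 2 else 0 :=
    Primrec.ite (Primrec.eq.comp (Primrec.nat_mod.comp Primrec.id (Primrec.const 2))
      (Primrec.const 0)) (Primrec.nat_div.comp Primrec.id (Primrec.const 2)) (Primrec.const 0)
  exact (h.to_comp.comp Rat.computable_encode_num).of_eq
    fun q => (Int.toNat_eq_of_encode q.num).symm

attribute [fun_prop] Computable.ofNat Rat.computable_encode_num Rat.computable_den
  Rat.computable_num_toNat

theorem Rat.computable_natCast_div : Computable fun p : ℕ × ℕ => (p.1 / p.2 : ℚ) := by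
  have hcode : ∀ q : ℚ, ∃ z, ∀ n, n = z ↔ ofNat ℚ n = q := fun q =>
    ⟨eqv ℚ q, fun n => ((eqv ℚ).symm_apply_eq).symm⟩
  obtain ⟨z, hz⟩ := hcode 0
  obtain ⟨E, hE, hEeq⟩ : ∃ E : ℕ → ℕ, Computable E ∧ ∀ n, E n = encode (ofNat ℚ n).num :=
    ⟨_, Rat.computable_encode_num.comp (Computable.ofNat ℚ), fun _ => rfl⟩
  obtain ⟨N, hN, hNeq⟩ : ∃ N : ℕ → ℕ, Computable N ∧ ∀ n, N n = (ofNat ℚ n).num.toNat :=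
    ⟨_, Rat.computable_num_toNat.comp (Computable.ofNat ℚ), fun _ => rfl⟩
  obtain ⟨D, hD, hDeq⟩ : ∃ D : ℕ → ℕ, Computable D ∧ ∀ n, D n = (ofNat ℚ n).den :=
    ⟨_, Rat.computable_den.comp (Computable.ofNat ℚ), fun _ => rfl⟩
  have hP : ∀ (p : ℕ × ℕ) n, ((p.2 == 0 && n == z) ||
      (!(p.2 == 0) && E n % 2 == 0 && N n * p.2 == p.1 * D n)) = true ↔
        ofNat ℚ n = p.1 / p.2 := by
    intro p n
    rw [hEeq, hNeq, hDeq]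
    by_cases h : p.2 = 0
    · simp [h, hz]
    · simp only [h, Bool.or_eq_true, Bool.and_eq_true, beq_iff_eq, false_and, Bool.not_eq_true',
        beq_eq_false_iff_ne, ne_eq, not_false_eq_true, true_and, false_or,
        ← Int.nonneg_iff_encode]
      generalize ofNat ℚ n = q
      have hp : (p.2 : ℚ) ≠ 0 := by exact_mod_cast h
      constructor
      · rintro ⟨h0, h1⟩
        have h1' : (q.num : ℚ) * p.2 = p.1 * q.den := by
          have : (q.num.toNat : ℤ) = q.num := Int.toNat_of_nonneg h0
          rw [← this]
          exact_mod_cast h1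
        rw [eq_div_iff hp]
        have hd : (q.den : ℚ) ≠ 0 := by exact_mod_cast q.den_nz
        rw [← mul_left_inj' hd, ← h1']
        nth_rewrite 1 [← Rat.num_div_den q]
        field_simp
      · intro hq
        have h0 : 0 ≤ q.num := by
          rw [Rat.num_nonneg, hq]
          positivity
        refine ⟨h0, ?_⟩
        have h1 : (q.num : ℚ) * p.2 = p.1 * q.den := by
          rw [eq_div_iff hp] at hq
          have hd : (q.den : ℚ) ≠ 0 := by exact_mod_cast q.den_nz
          rw [← hq]
          nth_rewrite 2 [← Rat.num_div_den q]
          field_simp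
        have : (q.num.toNat : ℤ) = q.num := Int.toNat_of_nonneg h0
        rw [← this] at h1
        exact_mod_cast h1
  obtain ⟨f, hf, hfP⟩ := Computable.exists_least (p := fun (p : ℕ × ℕ) n =>
      (p.2 == 0 && n == z) || (!(p.2 == 0) && E n % 2 == 0 && N n * p.2 == p.1 * D n))
    (by fun_prop) fun p =>
      (hcode (p.1 / p.2)).imp fun n hn => (hP p n).2 ((hn n).1 rfl)
  exact ((Computable.ofNat ℚ).comp hf).of_eq fun p => (hP _ _).1 (hfP p).1

/-- A nonnegative rational-valued function is given by computable numerators and denominators. -/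
def RatComputable {α : Type*} [Primcodable α] (f : α → ℚ) : Prop :=
  ∃ a b : α → ℕ, Computable a ∧ Computable b ∧ ∀ x, 0 < b x ∧ f x = a x / b x

namespace RatComputable

variable {α β : Type*} [Primcodable α] [Primcodable β] {f g : α → ℚ} {n : α → ℕ}

theorem of_computable (hf : Computable f) (h0 : ∀ x, 0 ≤ f x) : RatComputable f := by
  refine ⟨_, _, Rat.computable_num_toNat.comp hf, Rat.computable_den.comp hf,
    fun x => ⟨(f x).pos, ?_⟩⟩
  have h : (((f x).num.toNat : ℤ) : ℚ) = (f x).num := by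
    rw [Int.toNat_of_nonneg (Rat.num_nonneg.2 (h0 x))]
  rw [Int.cast_natCast] at h
  rw [h, Rat.num_div_den]

theorem computable (hf : RatComputable f) : Computable f := by
  obtain ⟨a, b, ha, hb, h⟩ := hf
  exact (Rat.computable_natCast_div.comp (ha.pair hb)).of_eq fun x => (h x).2.symm

theorem comp (hf : RatComputable f) {k : β → α} (hk : Computable k) :
    RatComputable fun x => f (k x) := by
  obtain ⟨a, b, ha, hb, h⟩ := hf
  exact ⟨_, _, ha.comp hk, hb.comp hk, fun x => h (k x)⟩

theorem natCast (hn : Computable n) : RatComputable fun x => (n x : ℚ) :=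
  ⟨_, _, hn, Computable.const 1, fun x => by simp⟩

theorem mul (hf : RatComputable f) (hg : RatComputable g) :
    RatComputable fun x => f x * g x := by
  obtain ⟨a, b, ha, hb, h⟩ := hf
  obtain ⟨a', b', ha', hb', h'⟩ := hg
  refine ⟨fun x => a x * a' x, fun x => b x * b' x, by fun_prop, by fun_prop, fun x => ⟨?_, ?_⟩⟩
  · exact Nat.mul_pos (h x).1 (h' x).1
  · beta_reduce
    rw [(h x).2, (h' x).2]
    push_cast
    rw [div_mul_div_comm]

theorem div_natCast (hf : RatComputable f) (hn : Computable n) (h0 : ∀ x, 0 < n x) :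
    RatComputable fun x => f x / n x := by
  obtain ⟨a, b, ha, hb, h⟩ := hf
  refine ⟨a, fun x => b x * n x, by fun_prop, by fun_prop, fun x => ⟨?_, ?_⟩⟩
  · exact Nat.mul_pos (h x).1 (h0 x)
  · beta_reduce
    rw [(h x).2]
    push_cast
    rw [div_div]

theorem sub (hf : RatComputable f) (hg : RatComputable g) (hle : ∀ x, g x ≤ f x) :
    RatComputable fun x => f x - g x := by
  obtain ⟨a, b, ha, hb, h⟩ := hf
  obtain ⟨a', b', ha', hb', h'⟩ := hg
  refine ⟨fun x => a x * b' x - b x * a' x, fun x => b x * b' x, by fun_prop, by fun_prop,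
    fun x => ⟨?_, ?_⟩⟩
  · exact Nat.mul_pos (h x).1 (h' x).1
  · have h1 : (0 : ℚ) < b x := by exact_mod_cast (h x).1
    have h2 : (0 : ℚ) < b' x := by exact_mod_cast (h' x).1
    have h3 := hle x
    rw [(h x).2, (h' x).2, div_le_div_iff₀ h2 h1] at h3
    have h4 : b x * a' x ≤ a x * b' x := by
      rw [mul_comm (b x)]
      exact_mod_cast h3
    beta_reduce
    rw [(h x).2, (h' x).2, Nat.cast_sub h4, div_sub_div _ _ h1.ne' h2.ne']
    push_cast
    rfl

theorem sum_range {f : α → ℕ → ℚ} (hf : RatComputable fun p : α × ℕ => f p.1 p.2)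
    (hn : Computable n) : RatComputable fun x => ∑ i ∈ Finset.range (n x), f x i := by
  obtain ⟨a, b, ha, hb, h⟩ := hf
  let S : α → ℕ → ℕ × ℕ := fun x k => Nat.rec (motive := fun _ => ℕ × ℕ) (0, 1)
    (fun i p => (p.1 * b (x, i) + p.2 * a (x, i), p.2 * b (x, i))) k
  have hS : Computable fun x => S x (n x) := by
    unfold S
    fun_prop
  have key : ∀ x k, 0 < (S x k).2 ∧ ∑ i ∈ Finset.range k, f x i = (S x k).1 / (S x k).2 := by
    intro x k
    induction k with
    | zero => simp [S]
    | succ k ih =>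
      have h1 : (S x (k + 1)) = ((S x k).1 * b (x, k) + (S x k).2 * a (x, k),
        (S x k).2 * b (x, k)) := rfl
      rw [h1]
      obtain ⟨h2, h3⟩ := h (x, k)
      refine ⟨Nat.mul_pos ih.1 h2, ?_⟩
      have h4 : ((S x k).2 : ℚ) ≠ 0 := by exact_mod_cast ih.1.ne'
      have h5 : (b (x, k) : ℚ) ≠ 0 := by exact_mod_cast h2.ne'
      rw [Finset.sum_range_succ, ih.2]
      simp only at h3
      rw [h3, div_add_div _ _ h4 h5]
      push_cast
      rfl
  exact ⟨_, _, Computable.fst.comp hS, Computable.snd.comp hS, fun x => key x (n x)⟩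

theorem natFloor (hf : RatComputable f) : Computable fun x => ⌊f x⌋₊ := by
  obtain ⟨a, b, ha, hb, h⟩ := hf
  exact (ha.natDiv hb).of_eq fun x => by rw [(h x).2, Nat.floor_div_eq_div]

theorem exists_decide_le (hf : RatComputable f) (hg : RatComputable g) :
    ∃ c : α → Bool, Computable c ∧ ∀ x, c x = true ↔ f x ≤ g x := by
  obtain ⟨a, b, ha, hb, h⟩ := hf
  obtain ⟨a', b', ha', hb', h'⟩ := hg
  refine ⟨fun x => Nat.ble (a x * b' x) (a' x * b x), by fun_prop, fun x => ?_⟩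
  have h1 : (0 : ℚ) < b x := by exact_mod_cast (h x).1
  have h2 : (0 : ℚ) < b' x := by exact_mod_cast (h' x).1
  rw [(h x).2, (h' x).2, div_le_div_iff₀ h1 h2, Nat.ble_eq]
  norm_cast

theorem option_elim {o : α → Option β} (ho : Computable o) {f : α → β → ℚ}
    (hf : RatComputable fun p : α × β => f p.1 p.2) :
    RatComputable fun x => (o x).elim 0 (f x) := by
  obtain ⟨a, b, ha, hb, h⟩ := hf
  refine ⟨fun x => (o x).casesOn (motive := fun _ => ℕ) 0 fun y => a (x, y),
    fun x => (o x).casesOn (motive := fun _ => ℕ) 1 fun y => b (x, y),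
    Computable.option_casesOn ho (Computable.const 0) ha.to₂,
    Computable.option_casesOn ho (Computable.const 1) hb.to₂, fun x => ?_⟩
  beta_reduce
  cases o x with
  | none => simp
  | some y => exact h (x, y)

theorem bifCond {c : α → Bool} (hc : Computable c) (hf : RatComputable f)
    (hg : RatComputable g) : RatComputable fun x => bif c x then f x else g x := by
  obtain ⟨a, b, ha, hb, h⟩ := hf
  obtain ⟨a', b', ha', hb', h'⟩ := hg
  refine ⟨fun x => bif c x then a x else a' x, fun x => bif c x then b x else b' x,
    by fun_prop, by fun_prop, fun x => ?_⟩
  beta_reduce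
  cases c x
  · exact h' x
  · exact h x

end RatComputable

/-- Weights with which a jump of the `j`-th approximation to the total mass is rewarded. -/
def jumpWeight (j : ℕ) : ℚ := 1 / (2 * (j + 1) * (j + 2) * 2 ^ j : ℕ)

theorem jumpWeight_pos (j : ℕ) : 0 < jumpWeight j := by
  unfold jumpWeight
  positivity

/-- The weighted number of the dyadic levels that the sequence `Ω` has climbed up to time `t`. -/
def jumpMass (Ω : ℕ → ℚ) (t : ℕ) : ℚ :=
  ∑ j ∈ Finset.range (t + 1), ((⌊(2 ^ j : ℕ) * Ω t⌋₊ + 1 : ℕ) : ℚ) * jumpWeight j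

theorem floor_pow_mul_le {q : ℚ} (h1 : q ≤ 1) (j : ℕ) : ⌊((2 ^ j : ℕ) : ℚ) * q⌋₊ ≤ 2 ^ j := by
  calc ⌊((2 ^ j : ℕ) : ℚ) * q⌋₊ ≤ ⌊((2 ^ j : ℕ) : ℚ)⌋₊ :=
        Nat.floor_mono (mul_le_of_le_one_right (by positivity) h1)
    _ = 2 ^ j := Nat.floor_natCast _

theorem jumpMass_le_one {Ω : ℕ → ℚ} (h1 : ∀ t, Ω t ≤ 1) (t : ℕ) : jumpMass Ω t ≤ 1 := by
  have hterm : ∀ j : ℕ, ((⌊(2 ^ j : ℕ) * Ω t⌋₊ + 1 : ℕ) : ℚ) * jumpWeight j ≤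
      1 / (j + 1) - 1 / (j + 2) := by
    intro j
    have h : ⌊((2 ^ j : ℕ) : ℚ) * Ω t⌋₊ + 1 ≤ 2 * 2 ^ j := by
      have := floor_pow_mul_le (h1 t) j
      have := Nat.one_le_two_pow (n := j)
      omega
    calc ((⌊(2 ^ j : ℕ) * Ω t⌋₊ + 1 : ℕ) : ℚ) * jumpWeight j
        ≤ ((2 * 2 ^ j : ℕ) : ℚ) * jumpWeight j := by
          have := (jumpWeight_pos j).le
          gcongr
      _ = 1 / (j + 1) - 1 / (j + 2) := by
          unfold jumpWeight
          push_cast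
          field_simp
          ring
  have hsum : ∀ n : ℕ, ∑ j ∈ Finset.range n, ((1 : ℚ) / (j + 1) - 1 / (j + 2)) =
      1 - 1 / (n + 1) := by
    intro n
    induction n with
    | zero => simp
    | succ n ih =>
      rw [Finset.sum_range_succ, ih]
      push_cast
      ring
  calc jumpMass Ω t ≤ _ := Finset.sum_le_sum fun j _ => hterm j
    _ = 1 - 1 / ((t + 1 : ℕ) + 1) := hsum _
    _ ≤ 1 := sub_le_self _ (by positivity)

theorem le_jumpMass_succ_sub {Ω : ℕ → ℚ} (hmono : Monotone Ω) (t : ℕ) :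
    jumpMass Ω t ≤ jumpMass Ω (t + 1) ∧
    ∀ j ≤ t + 1, (j ≤ t → ⌊(2 ^ j : ℕ) * Ω t⌋₊ ≠ ⌊(2 ^ j : ℕ) * Ω (t + 1)⌋₊) →
      jumpMass Ω t + jumpWeight j ≤ jumpMass Ω (t + 1) := by
  have hterm : ∀ j : ℕ, ((⌊(2 ^ j : ℕ) * Ω t⌋₊ + 1 : ℕ) : ℚ) * jumpWeight j ≤
      ((⌊(2 ^ j : ℕ) * Ω (t + 1)⌋₊ + 1 : ℕ) : ℚ) * jumpWeight j := by
    intro j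
    have := (jumpWeight_pos j).le
    have := hmono (Nat.le_succ t)
    gcongr
  have hle := Finset.sum_le_sum (s := Finset.range (t + 1)) fun j _ => hterm j
  have hlast : ∀ j, jumpWeight j ≤
      ((⌊(2 ^ j : ℕ) * Ω (t + 1)⌋₊ + 1 : ℕ) : ℚ) * jumpWeight j := by
    intro j
    refine le_mul_of_one_le_left (jumpWeight_pos j).le ?_
    exact_mod_cast Nat.le_add_left 1 _
  constructor
  · rw [jumpMass, jumpMass, Finset.sum_range_succ _ (t + 1)]
    have := hlast (t + 1)
    have := jumpWeight_pos (t + 1)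
    linarith
  · intro j hj hjump
    rw [jumpMass, jumpMass, Finset.sum_range_succ _ (t + 1)]
    rcases hj.lt_or_eq with hj | rfl
    · have hj' : j ∈ Finset.range (t + 1) := Finset.mem_range.2 hj
      have h1 := Finset.sum_le_sum (s := (Finset.range (t + 1)).erase j) fun j _ => hterm j
      rw [← Finset.add_sum_erase _ _ hj', ← Finset.add_sum_erase (Finset.range (t + 1)) _ hj']
      have h2 : ⌊((2 ^ j : ℕ) : ℚ) * Ω t⌋₊ + 1 ≤ ⌊((2 ^ j : ℕ) : ℚ) * Ω (t + 1)⌋₊ :=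
        lt_of_le_of_ne (Nat.floor_mono (mul_le_mul_of_nonneg_left (hmono (Nat.le_succ t))
          (by positivity))) (hjump (Nat.lt_succ_iff.1 hj))
      have h3 : ((⌊(2 ^ j : ℕ) * Ω t⌋₊ + 1 : ℕ) : ℚ) * jumpWeight j + jumpWeight j ≤
          ((⌊(2 ^ j : ℕ) * Ω (t + 1)⌋₊ + 1 : ℕ) : ℚ) * jumpWeight j := by
        rw [← add_one_mul]
        have := (jumpWeight_pos j).le
        refine mul_le_mul_of_nonneg_right ?_ this
        exact_mod_cast Nat.succ_le_succ h2
      have h4 := hlast (t + 1)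
      have h5 := jumpWeight_pos (t + 1)
      linarith
    · have := hlast (t + 1)
      linarith

/-- The times at which a bounded increasing sequence of rationals gets close to its supremum carry
large mass for some computable semimeasure on the naturals. -/
theorem exists_ratCode_of_monotone {Ω : ℕ → ℚ} (hΩ : RatComputable Ω) (hmono : Monotone Ω)
    (h0 : ∀ t, 0 ≤ Ω t) (h1 : ∀ t, Ω t ≤ 1) :
    ∃ Q : ℕ → ℚ, RatComputable Q ∧ (∀ t, 0 ≤ Q t) ∧ (∀ n, ∑ t ∈ Finset.range n, Q t ≤ 1) ∧
      ∀ j, ∃ t, jumpWeight j ≤ Q t ∧ ∀ s, t ≤ s → Ω s ≤ Ω t + 1 / 2 ^ j := by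
  have hW : RatComputable (jumpMass Ω) := by
    refine RatComputable.sum_range (f := fun t j =>
      ((⌊(2 ^ j : ℕ) * Ω t⌋₊ + 1 : ℕ) : ℚ) * jumpWeight j) (.mul (.natCast ?_) ?_) (by fun_prop)
    · have : Computable fun p : ℕ × ℕ => ⌊((2 ^ p.2 : ℕ) : ℚ) * Ω p.1⌋₊ :=
        ((RatComputable.natCast (by fun_prop)).mul (hΩ.comp Computable.fst)).natFloor
      fun_prop
    · refine RatComputable.comp (f := jumpWeight) ?_ Computable.snd
      have h := RatComputable.div_natCast (f := fun _ : ℕ => ((1 : ℕ) : ℚ))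
        (n := fun j => 2 * (j + 1) * (j + 2) * 2 ^ j)
        (.natCast (by fun_prop)) (by fun_prop) fun j => by positivity
      simp only [Nat.cast_one] at h
      exact h
  have hWp : RatComputable fun t : ℕ => bif t == 0 then ((0 : ℕ) : ℚ) else jumpMass Ω (t - 1) :=
    .bifCond (by fun_prop) (.natCast (by fun_prop)) (hW.comp (by fun_prop))
  have hW0 : jumpWeight 0 ≤ jumpMass Ω 0 := by
    rw [jumpMass, Finset.sum_range_one]
    refine le_mul_of_one_le_left (jumpWeight_pos 0).le ?_
    exact_mod_cast Nat.le_add_left 1 _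
  have hle : ∀ t : ℕ, (bif t == 0 then ((0 : ℕ) : ℚ) else jumpMass Ω (t - 1)) ≤ jumpMass Ω t := by
    intro t
    cases t with
    | zero => simpa using (jumpWeight_pos 0).le.trans hW0
    | succ t => simpa using (le_jumpMass_succ_sub hmono t).1
  refine ⟨_, hW.sub hWp hle, fun t => sub_nonneg.2 (hle t), fun n => ?_, fun j => ?_⟩
  · have : ∀ n, ∑ t ∈ Finset.range (n + 1),
        (jumpMass Ω t - bif t == 0 then ((0 : ℕ) : ℚ) else jumpMass Ω (t - 1)) =
          jumpMass Ω n := by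
      intro n
      induction n with
      | zero => simp
      | succ n ih =>
        rw [Finset.sum_range_succ, ih]
        simp
    cases n with
    | zero => simp
    | succ n =>
      rw [this]
      exact jumpMass_le_one h1 n
  · let u : ℕ → ℕ := fun t => ⌊((2 ^ j : ℕ) : ℚ) * Ω t⌋₊
    have hu : Monotone u := fun a b hab =>
      Nat.floor_mono (mul_le_mul_of_nonneg_left (hmono hab) (by positivity))
    have hstab : ∃ t, j ≤ t ∧ ∀ s, t ≤ s → u s ≤ u t := by
      have hb : BddAbove (Set.range u) := ⟨2 ^ j, by
        rintro _ ⟨t, rfl⟩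
        exact floor_pow_mul_le (h1 t) j⟩
      obtain ⟨t, ht⟩ := Nat.sSup_mem (Set.range_nonempty u) hb
      refine ⟨max t j, le_max_right _ _, fun s _ => ?_⟩
      exact (le_csSup hb ⟨s, rfl⟩).trans (ht ▸ hu (le_max_left t j))
    classical
    obtain ⟨hjt, ht⟩ := Nat.find_spec hstab
    have hmin := fun k => Nat.find_min hstab (m := k)
    generalize Nat.find hstab = t at hjt ht hmin
    refine ⟨t, ?_, fun s hs => ?_⟩
    · cases t with
      | zero =>
        obtain rfl : j = 0 := by omega
        simpa using hW0
      | succ t =>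
        have := (le_jumpMass_succ_sub hmono t).2 j hjt fun hj heq => by
          refine hmin t (Nat.lt_succ_self t) ⟨hj, fun s hs => ?_⟩
          rcases hs.eq_or_lt with rfl | hs
          · exact le_rfl
          · exact (ht s hs).trans heq.ge
        simp only [cond_false, Nat.add_sub_cancel, (by simp : (t + 1 == 0) = false)]
        linarith
    · have h2 : ((2 ^ j : ℕ) : ℚ) * Ω s < u s + 1 := Nat.lt_floor_add_one _
      have h3 : (u t : ℚ) ≤ ((2 ^ j : ℕ) : ℚ) * Ω t :=
        Nat.floor_le (mul_nonneg (by positivity) (h0 t))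
      have h4 : (u s : ℚ) ≤ u t := by exact_mod_cast ht s hs
      push_cast at h2 h3
      have h5 : (2 : ℚ) ^ j * Ω s ≤ 2 ^ j * Ω t + 1 := by linarith
      have h6 : (0 : ℚ) < 2 ^ j := by positivity
      refine le_of_mul_le_mul_left ?_ h6
      rw [mul_add, mul_one_div_cancel h6.ne']
      exact h5

theorem qval_mono : Monotone qval := fun _ _ h => ENNReal.ofReal_le_ofReal (by exact_mod_cast h)

theorem qval_le_qval_iff {p q : ℚ} (hq : 0 ≤ q) : qval p ≤ qval q ↔ p ≤ q := by
  rw [qval, qval, ENNReal.ofReal_le_ofReal_iff (by exact_mod_cast hq)]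
  norm_cast

theorem qval_natCast (n : ℕ) : qval n = n := by
  simp [qval]

theorem qval_add {p q : ℚ} (hp : 0 ≤ p) (hq : 0 ≤ q) : qval (p + q) = qval p + qval q := by
  rw [qval, Rat.cast_add, ENNReal.ofReal_add (by exact_mod_cast hp) (by exact_mod_cast hq)]
  rfl

theorem qval_mul {p q : ℚ} (hp : 0 ≤ p) : qval (p * q) = qval p * qval q := by
  rw [qval, Rat.cast_mul, ENNReal.ofReal_mul (by exact_mod_cast hp)]
  rfl

theorem qval_sum {ι : Type*} (F : Finset ι) {h : ι → ℚ} (h0 : ∀ i, 0 ≤ h i) :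
    qval (∑ i ∈ F, h i) = ∑ i ∈ F, qval (h i) := by
  rw [qval, Rat.cast_sum, ENNReal.ofReal_sum_of_nonneg fun i _ => by exact_mod_cast h0 i]
  rfl

theorem IsApproxFromBelow.qval_le {m : List Bool → ℝ≥0∞} {mt : List Bool → ℕ → ℚ}
    (hmt : IsApproxFromBelow m mt) (x : List Bool) (s : ℕ) : qval (mt x s) ≤ m x := by
  rw [hmt.2.2.2 x]
  exact le_iSup (fun s => qval (mt x s)) s

theorem IsApproxFromBelow.ratComputable {m : List Bool → ℝ≥0∞} {mt : List Bool → ℕ → ℚ}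
    (hmt : IsApproxFromBelow m mt) : RatComputable fun p : List Bool × ℕ => mt p.1 p.2 :=
  .of_computable hmt.1 fun p => hmt.2.1 p.1 p.2

theorem computable_zeros : Computable zeros := by
  have h : Computable fun t : ℕ => Nat.rec (motive := fun _ => List Bool) []
      (fun _ l => false :: l) t :=
    Computable.natRec Computable.id (Computable.const [])
      (Computable.list_cons.comp (Computable.const false)
        (Computable.snd.comp Computable.snd))
  refine h.of_eq fun t => ?_
  induction t with
  | zero => rfl
  | succ t ih => simp only [ih, zeros, List.replicate_succ]

theorem sum_le_sum_range_decode {h : List Bool → ℚ} (h0 : ∀ x, 0 ≤ h x)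
    {F : Finset (List Bool)} {n : ℕ} (hF : ∀ x ∈ F, encode x < n) :
    ∑ x ∈ F, h x ≤ ∑ i ∈ Finset.range n, (decode₂ (List Bool) i).elim 0 h := by
  have h1 : ∑ x ∈ F, h x =
      ∑ i ∈ F.image encode, (decode₂ (List Bool) i).elim 0 h := by
    rw [Finset.sum_image fun x _ y _ hxy => encode_injective hxy]
    exact Finset.sum_congr rfl fun x _ => by simp [decode₂_encode]
  rw [h1]
  refine Finset.sum_le_sum_of_subset_of_nonneg ?_ fun i _ _ => ?_
  · intro i hi
    obtain ⟨x, hx, rfl⟩ := Finset.mem_image.1 hi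
    exact Finset.mem_range.2 (hF x hx)
  · cases (decode₂ (List Bool) i) with
    | none => exact le_rfl
    | some x => exact h0 x

theorem sum_range_decode_le_one {h : List Bool → ℚ} (h0 : ∀ x, 0 ≤ h x)
    (h1 : ∑' x, qval (h x) ≤ 1) (n : ℕ) :
    ∑ i ∈ Finset.range n, (decode₂ (List Bool) i).elim 0 h ≤ 1 := by
  have key : qval (∑ i ∈ Finset.range n, (decode₂ (List Bool) i).elim 0 h) ≤ 1 := by
    rw [qval_sum]
    · calc ∑ i ∈ Finset.range n, qval ((decode₂ (List Bool) i).elim 0 h)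
          ≤ ∑' i : ℕ, qval ((decode₂ (List Bool) i).elim 0 h) := ENNReal.sum_le_tsum _
        _ = ∑' x : List Bool, qval (h x) := by
            have hinj := encode_injective (α := List Bool)
            rw [← hinj.tsum_eq (f := fun i : ℕ => qval ((decode₂ (List Bool) i).elim 0 h))]
            · simp [decode₂_encode]
            · intro i hi
              rw [← decode₂_ne_none_iff]
              rintro h
              simp [h, qval] at hi
        _ ≤ 1 := h1
    · intro i
      cases (decode₂ (List Bool) i) with
      | none => exact le_rfl
      | some x => exact h0 x
  rw [← Nat.cast_one (R := ℝ≥0∞), ← qval_natCast, qval_le_qval_iff (by simp)] at key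
  simpa using key

theorem length_zeros (t : ℕ) : (zeros t).length = t := List.length_replicate

/-- A computable semimeasure on the naturals is dominated, at a computable stage, by any
approximation from below of a universal semimeasure. -/
theorem IsUniversalSemimeasure.exists_stage {m : List Bool → ℝ≥0∞} {mt : List Bool → ℕ → ℚ}
    (hm : IsUniversalSemimeasure m) (hmt : IsApproxFromBelow m mt) {Q : ℕ → ℚ}
    (hQ : RatComputable Q) (h0 : ∀ t, 0 ≤ Q t) (h1 : ∀ n, ∑ t ∈ Finset.range n, Q t ≤ 1) :
    ∃ (K : ℕ) (f : ℕ → ℕ), 0 < K ∧ Computable f ∧ ∀ t, Q t ≤ K * mt (zeros t) (f t) := by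
  let P : List Bool → ℚ := fun x => bif x == zeros x.length then Q x.length else ((0 : ℕ) : ℚ)
  have hPc : RatComputable P :=
    .bifCond ((Computable.bEq Computable.id (computable_zeros.comp Computable.list_length)).of_eq
        fun x => by rw [Bool.eq_iff_iff]; simp)
      (hQ.comp Computable.list_length) (.natCast (Computable.const 0))
  have hP0 : ∀ x, 0 ≤ P x := fun x => by
    simp only [P]
    cases x == zeros x.length
    · simp
    · exact h0 _
  have hPz : ∀ t, P (zeros t) = Q t := fun t => by simp [P, length_zeros]
  have hPs : IsSemimeasure fun x => qval (P x) := by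
    have hinj : Function.Injective zeros := fun a b h => by
      simpa [length_zeros] using congrArg List.length h
    have h2 : ∑' x, qval (P x) = ∑' t, qval (P (zeros t)) := by
      rw [hinj.tsum_eq (f := fun x => qval (P x))]
      intro x hx
      by_contra hne
      have : (x == zeros x.length) = false := beq_eq_false_iff_ne.2 fun h => hne ⟨_, h.symm⟩
      simp [P, this, qval] at hx
    rw [IsSemimeasure, h2]
    refine ENNReal.tsum_le_of_sum_range_le fun n => ?_
    simp only [hPz]
    rw [← qval_sum _ h0]
    refine (qval_mono (h1 n)).trans_eq ?_
    simpa using qval_natCast 1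
  obtain ⟨c, -, hc⟩ := hm.2.2 _ hPs ⟨fun x _ => P x, hPc.computable.comp Computable.fst,
    fun x _ => hP0 x, fun x => monotone_const, fun x => by simp⟩
  obtain ⟨K, hK⟩ := exists_nat_gt c
  have hK0 : 0 < K := by
    have : (0 : ℝ≥0) < K := hK.trans_le' zero_le
    exact_mod_cast this
  have hex : ∀ t, ∃ s, Q t ≤ K * mt (zeros t) s := by
    intro t
    by_contra! hlt
    have hQpos : 0 < Q t := lt_of_le_of_lt
      (mul_nonneg (Nat.cast_nonneg K) (hmt.2.1 (zeros t) 0)) (hlt 0)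
    have hle : (K : ℝ≥0∞) * m (zeros t) ≤ qval (Q t) := by
      rw [hmt.2.2.2, ENNReal.mul_iSup]
      refine iSup_le fun s => ?_
      rw [← qval_natCast, ← qval_mul (Nat.cast_nonneg K)]
      exact qval_mono (hlt s).le
    have hcm := hc (zeros t)
    simp only [hPz] at hcm
    have hqpos : 0 < qval (Q t) := ENNReal.ofReal_pos.2 (by exact_mod_cast hQpos)
    have hm0 : m (zeros t) ≠ 0 := by
      intro h
      simp [h] at hcm
      exact hqpos.ne' hcm
    have hm1 : m (zeros t) ≠ ⊤ :=
      (((ENNReal.le_tsum _).trans hm.1).trans_lt ENNReal.one_lt_top).ne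
    have hKc : (K : ℝ≥0∞) ≤ c := (ENNReal.mul_le_mul_iff_left hm0 hm1).1 (hle.trans hcm)
    rw [← ENNReal.coe_natCast, ENNReal.coe_le_coe] at hKc
    exact absurd hK (not_lt.2 hKc)
  have hmz : RatComputable fun p : ℕ × ℕ => mt (zeros p.1) p.2 :=
    hmt.ratComputable.comp (k := fun p : ℕ × ℕ => (zeros p.1, p.2))
      ((computable_zeros.comp Computable.fst).pair Computable.snd)
  have hKm : RatComputable fun p : ℕ × ℕ => (K : ℚ) * mt (zeros p.1) p.2 :=
    (RatComputable.natCast (Computable.const K)).mul hmz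
  have hQf : RatComputable fun p : ℕ × ℕ => Q p.1 := hQ.comp Computable.fst
  obtain ⟨d, hd, hdeq⟩ := hQf.exists_decide_le hKm
  obtain ⟨f, hf, hfd⟩ := Computable.exists_least (p := fun t s => d (t, s)) hd
    fun t => (hex t).imp fun s hs => (hdeq (t, s)).2 hs
  exact ⟨K, f, hK0, hf, fun t => (hdeq (t, f t)).1 (hfd t).1⟩

/-- The times at which the total mass of the approximation gets close to its supremum are, at a
computable stage, seen to be simple. -/
theorem IsUniversalSemimeasure.exists_simple_settling_times {m : List Bool → ℝ≥0∞}
    {mt : List Bool → ℕ → ℚ} (hm : IsUniversalSemimeasure m) (hmt : IsApproxFromBelow m mt) :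
    ∃ (K : ℕ) (f : ℕ → ℕ), 0 < K ∧ Computable f ∧ ∀ j, ∃ t,
      jumpWeight j ≤ K * mt (zeros t) (f t) ∧ ∀ (F : Finset (List Bool)) (s : ℕ), t ≤ s →
        ∑ x ∈ F, mt x s ≤ ∑ x ∈ F, mt x t + 1 / 2 ^ j := by
  let Ω : ℕ → ℕ → ℚ := fun n t =>
    ∑ i ∈ Finset.range n, (decode₂ (List Bool) i).elim 0 fun x => mt x t
  have hnn : ∀ i t, 0 ≤ (decode₂ (List Bool) i).elim 0 fun x => mt x t := by
    intro i t
    cases decode₂ (List Bool) i with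
    | none => exact le_rfl
    | some x => exact hmt.2.1 x t
  have hΩl : ∀ {n n'} t, n ≤ n' → Ω n t ≤ Ω n' t := fun t h =>
    Finset.sum_le_sum_of_subset_of_nonneg (Finset.range_subset_range.2 h) fun i _ _ => hnn i t
  have hΩr : ∀ n {t t'}, t ≤ t' → Ω n t ≤ Ω n t' := fun n t t' h =>
    Finset.sum_le_sum fun i _ => by
      cases decode₂ (List Bool) i with
      | none => exact le_rfl
      | some x => exact hmt.2.2.1 x h
  have hΩc : RatComputable fun t => Ω t t := by
    have hmp : RatComputable fun q : (ℕ × ℕ) × List Bool => mt q.2 q.1.1 :=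
      hmt.ratComputable.comp (k := fun q : (ℕ × ℕ) × List Bool => (q.2, q.1.1))
        (Computable.snd.pair (Computable.fst.comp Computable.fst))
    have hdec : Computable fun p : ℕ × ℕ => decode₂ (List Bool) p.2 :=
      Primrec.decode₂.to_comp.comp Computable.snd
    have helim : RatComputable fun p : ℕ × ℕ =>
        (decode₂ (List Bool) p.2).elim 0 fun x => mt x p.1 :=
      RatComputable.option_elim hdec (f := fun p x => mt x p.1) hmp
    exact RatComputable.sum_range
      (f := fun t i => (decode₂ (List Bool) i).elim 0 fun x => mt x t) helim Computable.id
  have hΩ1 : ∀ n t, Ω n t ≤ 1 := fun n t =>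
    sum_range_decode_le_one (fun x => hmt.2.1 x t)
      ((ENNReal.tsum_le_tsum fun x => hmt.qval_le x t).trans hm.1) n
  obtain ⟨Q, hQ, hQ0, hQ1, hj⟩ := exists_ratCode_of_monotone hΩc
    (fun t t' h => (hΩl t h).trans (hΩr t' h)) (fun t => Finset.sum_nonneg fun i _ => hnn i t)
    fun t => hΩ1 t t
  obtain ⟨K, f, hK, hf, hKf⟩ := hm.exists_stage hmt hQ hQ0 hQ1
  refine ⟨K, f, hK, hf, fun j => ?_⟩
  obtain ⟨t, ht, hts⟩ := hj j
  refine ⟨t, ht.trans (hKf t), fun F s hs => ?_⟩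
  let n := max s (F.sup encode + 1)
  have hF : ∀ x ∈ F, encode x < n := fun x hx =>
    lt_of_lt_of_le (Nat.lt_succ_of_le (Finset.le_sup (f := encode) hx)) (le_max_right _ _)
  have h1 := sum_le_sum_range_decode (h := fun x => mt x n - mt x t)
    (fun x => sub_nonneg.2 (hmt.2.2.1 x (hs.trans (le_max_left _ _)))) hF
  have h2 : ∑ i ∈ Finset.range n, (decode₂ (List Bool) i).elim 0 (fun x => mt x n - mt x t) =
      Ω n n - Ω n t := by
    rw [← Finset.sum_sub_distrib]
    refine Finset.sum_congr rfl fun i _ => ?_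
    cases decode₂ (List Bool) i <;> simp
  have h3 : ∑ x ∈ F, mt x s ≤ ∑ x ∈ F, mt x n :=
    Finset.sum_le_sum fun x _ => hmt.2.2.1 x (le_max_left _ _)
  rw [h2, Finset.sum_sub_distrib] at h1
  have h4 := hts n (hs.trans (le_max_left _ _))
  have h5 := hΩl t (hs.trans (le_max_left s (F.sup encode + 1)))
  simp only [n] at *
  linarith

/-- The condition under which the test `etest` is large. -/
def EtestCond (mt : List Bool → ℕ → ℚ) (f : ℕ → ℕ) (g : List Bool × ℕ → ℕ)
    (x : List Bool) : Prop :=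
  ∀ t : ℕ,
    qval (mt (zeros t) (f t)) ≤ ENNReal.ofReal (6 * Real.logb 2 x.length / x.length) ∨
    2 * qval (mt x t) ≤ qval (mt x (g (x, t)))

theorem IsApproxFromBelow.tsum_indicator_le {m : List Bool → ℝ≥0∞} {mt : List Bool → ℕ → ℚ}
    (hm : IsSemimeasure m) (hmt : IsApproxFromBelow m mt) {t j : ℕ}
    (hgap : ∀ (F : Finset (List Bool)) (s : ℕ), t ≤ s →
      ∑ x ∈ F, mt x s ≤ ∑ x ∈ F, mt x t + 1 / 2 ^ j)
    {A : Set (List Bool)} (hA : ∀ x ∈ A, 2 * qval (mt x t) ≤ m x) :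
    ∑' x, A.indicator m x ≤ ENNReal.ofReal (2 / 2 ^ j) := by
  classical
  rw [ENNReal.tsum_eq_iSup_sum]
  refine iSup_le fun F => ?_
  simp only [Set.indicator_apply, ← Finset.sum_filter]
  set G := F.filter (· ∈ A)
  have h1 : ∑ x ∈ G, m x ≤ ∑ x ∈ G, qval (mt x t) + ENNReal.ofReal (1 / 2 ^ j) := by
    have h2 : ∑ x ∈ G, m x = ⨆ s, ∑ x ∈ G, qval (mt x s) := by
      rw [← ENNReal.finsetSum_iSup_of_monotone
        (f := fun x s => qval (mt x s)) fun x => qval_mono.comp (hmt.2.2.1 x)]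
      exact Finset.sum_congr rfl fun x _ => hmt.2.2.2 x
    rw [h2]
    refine iSup_le fun s => ?_
    calc ∑ x ∈ G, qval (mt x s) ≤ ∑ x ∈ G, qval (mt x (max t s)) :=
          Finset.sum_le_sum fun x _ => qval_mono (hmt.2.2.1 x (le_max_right _ _))
      _ = qval (∑ x ∈ G, mt x (max t s)) := (qval_sum G fun x => hmt.2.1 x _).symm
      _ ≤ qval (∑ x ∈ G, mt x t + 1 / 2 ^ j) := qval_mono (hgap G _ (le_max_left _ _))
      _ = ∑ x ∈ G, qval (mt x t) + ENNReal.ofReal (1 / 2 ^ j) := by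
          rw [qval_add (Finset.sum_nonneg fun x _ => hmt.2.1 x t) (by positivity),
            qval_sum G fun x => hmt.2.1 x t]
          simp [qval]
  have h3 : 2 * ∑ x ∈ G, qval (mt x t) ≤ ∑ x ∈ G, m x := by
    rw [Finset.mul_sum]
    exact Finset.sum_le_sum fun x hx => hA x (Finset.mem_filter.1 hx).2
  have hfin : ∑ x ∈ G, m x ≠ ⊤ :=
    (((ENNReal.sum_le_tsum G).trans hm).trans_lt ENNReal.one_lt_top).ne
  have h4 : ∑ x ∈ G, m x + ∑ x ∈ G, m x ≤ ∑ x ∈ G, m x + ENNReal.ofReal (2 / 2 ^ j) := by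
    calc ∑ x ∈ G, m x + ∑ x ∈ G, m x = 2 * ∑ x ∈ G, m x := (two_mul _).symm
      _ ≤ 2 * (∑ x ∈ G, qval (mt x t) + ENNReal.ofReal (1 / 2 ^ j)) := by gcongr
      _ = 2 * ∑ x ∈ G, qval (mt x t) + ENNReal.ofReal (2 / 2 ^ j) := by
          rw [mul_add]
          congr 1
          rw [← ENNReal.ofReal_ofNat, ← ENNReal.ofReal_mul zero_le_two, mul_one_div]
      _ ≤ _ := by gcongr
  exact (ENNReal.add_le_add_iff_left hfin).1 h4

theorem log_le_logb_two (n : ℕ) : (Nat.log 2 n : ℝ) ≤ Real.logb 2 n := by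
  have := Real.natLog_le_logb n 2
  exact_mod_cast this

theorem logb_two_lt_log_add_one (n : ℕ) : Real.logb 2 n < Nat.log 2 n + 1 := by
  rcases Nat.eq_zero_or_pos n with rfl | hn
  · simp
  · rw [Real.logb_lt_iff_lt_rpow one_lt_two (by exact_mod_cast hn)]
    have := Nat.lt_pow_succ_log_self one_lt_two n
    exact_mod_cast this

theorem tsum_indicator_etestCond_le {m : List Bool → ℝ≥0∞} {mt : List Bool → ℕ → ℚ}
    (hm : IsSemimeasure m) (hmt : IsApproxFromBelow m mt) {K : ℕ} {f : ℕ → ℕ} (hK : 0 < K)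
    (hf : ∀ j, ∃ t, jumpWeight j ≤ K * mt (zeros t) (f t) ∧
      ∀ (F : Finset (List Bool)) (s : ℕ), t ≤ s →
        ∑ x ∈ F, mt x s ≤ ∑ x ∈ F, mt x t + 1 / 2 ^ j)
    (g : List Bool × ℕ → ℕ) {L : ℕ} (hL : 0 < L) :
    ∑' x, {x | EtestCond mt f g x ∧ Nat.log 2 x.length = L}.indicator m x ≤
      ENNReal.ofReal (48 * K * (L + 2) ^ 3 / 2 ^ L) := by
  obtain ⟨D, hD⟩ : ∃ D, D = 12 * K * (L + 2) ^ 3 := ⟨_, rfl⟩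
  have hDR : (D : ℝ) = 12 * K * (L + 2) ^ 3 := by rw [hD]; push_cast; rfl
  have hDpos : 0 < D := by rw [hD]; positivity
  have h2L : (0 : ℝ) < 2 ^ L := by positivity
  rcases lt_or_ge (2 ^ L) D with hlt | hge
  · calc ∑' x, {x | EtestCond mt f g x ∧ Nat.log 2 x.length = L}.indicator m x
        ≤ ∑' x, m x := ENNReal.tsum_le_tsum fun x => Set.indicator_le_self _ _ x
      _ ≤ ENNReal.ofReal 1 := by simpa [IsSemimeasure] using hm
      _ ≤ _ := by
        refine ENNReal.ofReal_le_ofReal ?_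
        rw [one_le_div h2L]
        have h : (2 : ℝ) ^ L < D := by exact_mod_cast hlt
        have h0 : (0 : ℝ) < D := by exact_mod_cast hDpos
        linarith
  · obtain ⟨j, hj⟩ : ∃ j, j = Nat.log 2 (2 ^ L / D) := ⟨_, rfl⟩
    have hq : 0 < 2 ^ L / D := Nat.div_pos hge hDpos
    have h1 : D * 2 ^ j ≤ 2 ^ L := by
      have := Nat.pow_log_le_self 2 hq.ne'
      rw [← hj, Nat.le_div_iff_mul_le hDpos] at this
      rwa [mul_comm]
    have h2 : 2 ^ L < D * 2 ^ (j + 1) := by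
      have := Nat.lt_pow_succ_log_self one_lt_two (2 ^ L / D)
      rw [← hj, Nat.div_lt_iff_lt_mul hDpos] at this
      rwa [mul_comm]
    have hjL : j ≤ L := by
      refine (Nat.pow_le_pow_iff_right one_lt_two).1 (le_trans ?_ h1)
      exact Nat.le_mul_of_pos_left _ hDpos
    obtain ⟨t, ht, hgap⟩ := hf j
    have h1R : (D : ℝ) * 2 ^ j ≤ 2 ^ L := by exact_mod_cast h1
    have h2R : (2 : ℝ) ^ L < D * 2 ^ (j + 1) := by exact_mod_cast h2
    refine (hmt.tsum_indicator_le hm hgap ?_).trans (ENNReal.ofReal_le_ofReal ?_)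
    · rintro x ⟨hx, hxL⟩
      rcases hx t with h | h
      · exfalso
        have hnum : 0 ≤ 6 * Real.logb 2 x.length :=
          mul_nonneg (by norm_num) ((Nat.cast_nonneg _).trans (log_le_logb_two x.length))
        rw [qval, ENNReal.ofReal_le_ofReal_iff (div_nonneg hnum (Nat.cast_nonneg _))] at h
        have hn0 : x.length ≠ 0 := by
          rintro h0
          rw [h0] at hxL
          simp at hxL
          omega
        have hn : (2 : ℝ) ^ L ≤ x.length := by
          have := Nat.pow_log_le_self 2 hn0
          rw [hxL] at this
          exact_mod_cast this
        have hlog := logb_two_lt_log_add_one x.length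
        rw [hxL] at hlog
        have htR : (1 : ℝ) / (2 * (j + 1) * (j + 2) * 2 ^ j) ≤ K * (mt (zeros t) (f t) : ℝ) := by
          have := (Rat.cast_le (K := ℝ)).2 ht
          rw [jumpWeight] at this
          push_cast at this
          exact this
        have hjR : (j : ℝ) ≤ L := by exact_mod_cast hjL
        have hKR : (0 : ℝ) < K := by exact_mod_cast hK
        have hc : K * (mt (zeros t) (f t) : ℝ) < K * (6 * (L + 1) / 2 ^ L) := by
          refine mul_lt_mul_of_pos_left (h.trans_lt ?_) hKR
          calc 6 * Real.logb 2 x.length / x.length ≤ 6 * Real.logb 2 x.length / 2 ^ L := by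
                gcongr
            _ < _ := by gcongr
        have hc2 := htR.trans_lt hc
        rw [← mul_div_assoc, div_lt_div_iff₀ (by positivity) h2L, one_mul] at hc2
        have hc3 : (K : ℝ) * (6 * (L + 1)) * (2 * (j + 1) * (j + 2) * 2 ^ j) ≤ D * 2 ^ j := by
          rw [hDR]
          calc (K : ℝ) * (6 * (L + 1)) * (2 * (j + 1) * (j + 2) * 2 ^ j)
              ≤ K * (6 * (L + 2)) * (2 * (L + 2) * (L + 2) * 2 ^ j) := by
                gcongr <;> linarith
            _ = _ := by ring
        linarith
      · exact h.trans (hmt.qval_le x _)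
    · rw [div_le_div_iff₀ (by positivity) h2L]
      rw [pow_succ] at h2R
      have : 48 * (K : ℝ) * (L + 2) ^ 3 * 2 ^ j = 4 * (D * 2 ^ j) := by rw [hDR]; ring
      rw [this]
      linarith

theorem exists_tsum_mul_etest_le {m : List Bool → ℝ≥0∞} {mt : List Bool → ℕ → ℚ}
    (hm : IsSemimeasure m) (hmt : IsApproxFromBelow m mt) {K : ℕ} {f : ℕ → ℕ} (hK : 0 < K)
    (hf : ∀ j, ∃ t, jumpWeight j ≤ K * mt (zeros t) (f t) ∧
      ∀ (F : Finset (List Bool)) (s : ℕ), t ≤ s →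
        ∑ x ∈ F, mt x s ≤ ∑ x ∈ F, mt x t + 1 / 2 ^ j) :
    ∃ N : ℕ, 0 < N ∧ ∀ g : List Bool × ℕ → ℕ, ∑' x, m x * etest mt f g x ≤ N := by
  have hsum : Summable fun L : ℕ => (96 * 27 * K : ℝ) * (1 / (L : ℝ) ^ 2) :=
    (Real.summable_one_div_nat_pow.2 one_lt_two).mul_left _
  obtain ⟨N, hN⟩ := exists_nat_gt (∑' L : ℕ, (96 * 27 * K : ℝ) * (1 / (L : ℝ) ^ 2))
  have hB : ∑' L : ℕ, ENNReal.ofReal ((96 * 27 * K : ℝ) * (1 / (L : ℝ) ^ 2)) ≤ N := by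
    rw [← ENNReal.ofReal_tsum_of_nonneg (fun L => by positivity) hsum,
      ← ENNReal.ofReal_natCast]
    exact ENNReal.ofReal_le_ofReal hN.le
  refine ⟨1 + N, by omega, fun g => ?_⟩
  let A : ℕ → Set (List Bool) := fun L => {x | EtestCond mt f g x ∧ Nat.log 2 x.length = L}
  have hpt : ∀ x, m x * etest mt f g x ≤
      m x + ∑' L, (A L).indicator m x * ENNReal.ofReal (2 ^ (L + 1) / (L : ℝ) ^ 5) := by
    intro x
    by_cases hx : EtestCond mt f g x
    · have he : etest mt f g x = ENNReal.ofReal (x.length / (Real.logb 2 x.length) ^ 5) :=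
        if_pos hx
      refine le_add_left (le_trans ?_ (ENNReal.le_tsum (Nat.log 2 x.length)))
      have hxA : x ∈ A (Nat.log 2 x.length) := ⟨hx, rfl⟩
      rw [Set.indicator_of_mem hxA, he]
      gcongr m x * ENNReal.ofReal ?_
      rcases Nat.eq_zero_or_pos (Nat.log 2 x.length) with h0 | h0
      · have h1 : x.length = 0 ∨ x.length = 1 := by
          rw [Nat.log_eq_zero_iff] at h0
          omega
        rcases h1 with h1 | h1 <;> simp [h1]
      · have h1 := log_le_logb_two x.length
        have h2 : (x.length : ℝ) ≤ 2 ^ (Nat.log 2 x.length + 1) := by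
          exact_mod_cast (Nat.lt_pow_succ_log_self one_lt_two x.length).le
        gcongr
    · have he : etest mt f g x = 1 := if_neg hx
      rw [he, mul_one]
      exact le_self_add
  calc ∑' x, m x * etest mt f g x
      ≤ ∑' x, (m x + ∑' L, (A L).indicator m x *
          ENNReal.ofReal (2 ^ (L + 1) / (L : ℝ) ^ 5)) := ENNReal.tsum_le_tsum hpt
    _ = ∑' x, m x + ∑' L, (∑' x, (A L).indicator m x) *
          ENNReal.ofReal (2 ^ (L + 1) / (L : ℝ) ^ 5) := by
        rw [ENNReal.tsum_add, ENNReal.tsum_comm]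
        simp only [ENNReal.tsum_mul_right]
    _ ≤ 1 + ∑' L : ℕ, ENNReal.ofReal ((96 * 27 * K : ℝ) * (1 / (L : ℝ) ^ 2)) := by
        refine add_le_add hm (ENNReal.tsum_le_tsum fun L => ?_)
        rcases Nat.eq_zero_or_pos L with rfl | hL
        · simp
        · calc (∑' x, (A L).indicator m x) * ENNReal.ofReal (2 ^ (L + 1) / (L : ℝ) ^ 5)
              ≤ ENNReal.ofReal (48 * K * (L + 2) ^ 3 / 2 ^ L) *
                ENNReal.ofReal (2 ^ (L + 1) / (L : ℝ) ^ 5) := by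
                gcongr
                exact tsum_indicator_etestCond_le hm hmt hK hf g hL
            _ ≤ _ := by
                rw [← ENNReal.ofReal_mul (by positivity)]
                refine ENNReal.ofReal_le_ofReal ?_
                have hL1 : (1 : ℝ) ≤ L := by exact_mod_cast hL
                calc 48 * (K : ℝ) * (L + 2) ^ 3 / 2 ^ L * (2 ^ (L + 1) / (L : ℝ) ^ 5)
                    = 96 * K * (L + 2) ^ 3 / (L : ℝ) ^ 5 := by
                      rw [pow_succ]
                      field_simp
                      ring
                  _ ≤ 96 * K * (3 * L) ^ 3 / (L : ℝ) ^ 5 := by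
                      gcongr
                      linarith
                  _ = _ := by
                      field_simp
                      ring
    _ ≤ 1 + N := by gcongr
    _ = (1 + N : ℕ) := by push_cast; rfl

theorem Computable.natCast_div_natCast {α : Type*} [Primcodable α] {a b : α → ℕ}
    (ha : Computable a) (hb : Computable b) : Computable fun x => (a x / b x : ℚ) :=
  (Rat.computable_natCast_div.comp (ha.pair hb)).of_eq fun _ => rfl

theorem UpperSemicomputable.inv_natCast_mul {e : List Bool → ℝ≥0∞} (he : UpperSemicomputable e)
    {k : ℕ} (hk : 0 < k) : UpperSemicomputable fun x => (((k : ℝ≥0)⁻¹ : ℝ≥0) : ℝ≥0∞) * e x := by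
  obtain ⟨es, hc, h0, hanti, hinf⟩ := he
  let h : ℚ → ℚ := fun q => (q.num.toNat : ℚ) / (k * q.den : ℕ)
  have hh : Computable h := Computable.natCast_div_natCast (b := fun q : ℚ => k * q.den)
    Rat.computable_num_toNat (Computable.natMul (Computable.const k) Rat.computable_den)
  have hkq : (0 : ℚ) < k := by exact_mod_cast hk
  have hheq : ∀ q : ℚ, 0 ≤ q → h q = (k : ℚ)⁻¹ * q := by
    intro q hq
    have h1 : (q.num.toNat : ℚ) = q.num := by
      rw [← Int.cast_natCast, Int.toNat_of_nonneg (Rat.num_nonneg.2 hq)]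
    have h2 : (q.den : ℚ) ≠ 0 := by exact_mod_cast q.den_nz
    simp only [h]
    rw [h1]
    nth_rewrite 3 [← Rat.num_div_den q]
    push_cast
    field_simp
  have hc0 : (((k : ℝ≥0)⁻¹ : ℝ≥0) : ℝ≥0∞) ≠ 0 := by
    simpa using hk.ne'
  have hval : ∀ x s, qtval ((es x s).map h) =
      (((k : ℝ≥0)⁻¹ : ℝ≥0) : ℝ≥0∞) * qtval (es x s) := by
    intro x s
    cases hx : es x s with
    | none => simp [qtval, ENNReal.mul_top hc0]
    | some a =>
      have ha := h0 x s a hx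
      simp only [Option.map_some, qtval, Option.elim_some]
      rw [hheq a ha, Rat.cast_mul, ENNReal.ofReal_mul (by positivity)]
      congr 1
      rw [← ENNReal.ofReal_coe_nnreal]
      push_cast
      rfl
  refine ⟨fun x s => (es x s).map h, Computable.option_map hc (hh.comp Computable.snd).to₂,
    fun x s a ha => ?_, fun x s t hst => ?_, fun x => ?_⟩
  · obtain ⟨b, hb, rfl⟩ := Option.mem_map.1 ha
    simp only [h]
    positivity
  · simp only [hval]
    exact mul_le_mul_right (hanti x hst) _
  · simp only [hval]
    rw [hinf x, ENNReal.mul_iInf_of_ne hc0 ENNReal.coe_ne_top]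

/-- Dyadic approximations of `n / (log n)⁵` from above. -/
def logRatio (n s : ℕ) : ℚ :=
  ((n * (2 ^ s) ^ 5 : ℕ) : ℚ) / (Nat.log 2 (n ^ 2 ^ s) ^ 5 : ℕ)

theorem computable_nat_log_two : Computable (Nat.log 2) := by
  obtain ⟨f, hf, hfs⟩ := Computable.exists_least (p := fun n k => Nat.ble (n + 1) (2 ^ (k + 1)))
    (by fun_prop) fun n : ℕ => ⟨n, by
      rw [Nat.ble_eq]
      exact (Nat.lt_two_pow_self).le.trans' le_rfl⟩
  refine hf.of_eq fun n => ?_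
  obtain ⟨h1, h2⟩ := hfs n
  refine le_antisymm (h2 _ ?_) ?_
  · rw [Nat.ble_eq]
    exact Nat.lt_pow_succ_log_self one_lt_two n
  · rw [Nat.ble_eq] at h1
    exact Nat.lt_succ_iff.1 (Nat.log_lt_of_lt_pow' (Nat.succ_ne_zero _) h1)

theorem computable_logRatio : Computable fun p : ℕ × ℕ => logRatio p.1 p.2 := by
  have h : Computable fun p : ℕ × ℕ => Nat.log 2 (p.1 ^ 2 ^ p.2) :=
    computable_nat_log_two.comp (by fun_prop)
  exact Computable.natCast_div_natCast
    (a := fun p : ℕ × ℕ => p.1 * (2 ^ p.2) ^ 5)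
    (b := fun p : ℕ × ℕ => Nat.log 2 (p.1 ^ 2 ^ p.2) ^ 5) (by fun_prop) (by fun_prop)

theorem logRatio_nonneg (n s : ℕ) : 0 ≤ logRatio n s := by
  unfold logRatio
  positivity

theorem cast_logRatio (n s : ℕ) :
    (logRatio n s : ℝ) = n / ((Nat.log 2 (n ^ 2 ^ s) : ℝ) / 2 ^ s) ^ 5 := by
  unfold logRatio
  push_cast
  rw [div_pow, div_div_eq_mul_div]

theorem monotone_dyadic_log {n : ℕ} (hn : 2 ≤ n) :
    Monotone fun s : ℕ => (Nat.log 2 (n ^ 2 ^ s) : ℝ) / 2 ^ s := by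
  refine monotone_nat_of_le_succ fun s => ?_
  have h : 2 * Nat.log 2 (n ^ 2 ^ s) ≤ Nat.log 2 (n ^ 2 ^ (s + 1)) := by
    have hne : n ^ 2 ^ s ≠ 0 := by positivity
    have h1 := Nat.pow_log_le_self 2 hne
    refine Nat.le_log_of_pow_le one_lt_two ?_
    calc 2 ^ (2 * Nat.log 2 (n ^ 2 ^ s)) = (2 ^ Nat.log 2 (n ^ 2 ^ s)) ^ 2 := by
          rw [mul_comm, pow_mul]
      _ ≤ (n ^ 2 ^ s) ^ 2 := by gcongr
      _ = n ^ 2 ^ (s + 1) := by rw [← pow_mul, pow_succ]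
  have hR : 2 * (Nat.log 2 (n ^ 2 ^ s) : ℝ) ≤ Nat.log 2 (n ^ 2 ^ (s + 1)) := by exact_mod_cast h
  rw [div_le_div_iff₀ (by positivity) (by positivity), pow_succ]
  have : (0 : ℝ) < 2 ^ s := by positivity
  nlinarith

theorem tendsto_dyadic_log (n : ℕ) :
    Filter.Tendsto (fun s : ℕ => (Nat.log 2 (n ^ 2 ^ s) : ℝ) / 2 ^ s) Filter.atTop
      (nhds (Real.logb 2 n)) := by
  have hpow : ∀ s : ℕ, Real.logb 2 ((n ^ 2 ^ s : ℕ) : ℝ) = 2 ^ s * Real.logb 2 n := by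
    intro s
    push_cast
    rw [Real.logb_pow]
    push_cast
    rfl
  have h1 : Filter.Tendsto (fun s : ℕ => Real.logb 2 n - 1 / (2 : ℝ) ^ s) Filter.atTop
      (nhds (Real.logb 2 n)) := by
    have h2 : Filter.Tendsto (fun s : ℕ => (1 / 2 : ℝ) ^ s) Filter.atTop (nhds 0) :=
      tendsto_pow_atTop_nhds_zero_of_lt_one (by norm_num) (by norm_num)
    simpa using h2.const_sub (Real.logb 2 n)
  refine tendsto_of_tendsto_of_tendsto_of_le_of_le h1 tendsto_const_nhds (fun s => ?_) fun s => ?_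
  · have h := logb_two_lt_log_add_one (n ^ 2 ^ s)
    rw [hpow] at h
    have hs : (0 : ℝ) < 2 ^ s := by positivity
    beta_reduce
    rw [sub_le_iff_le_add, ← add_div, le_div_iff₀ hs]
    linarith
  · have h := log_le_logb_two (n ^ 2 ^ s)
    rw [hpow] at h
    have hs : (0 : ℝ) < 2 ^ s := by positivity
    beta_reduce
    rw [div_le_iff₀ hs]
    linarith

theorem antitone_qval_logRatio (n : ℕ) : Antitone fun s => qval (logRatio n s) := by
  intro s t hst
  refine ENNReal.ofReal_le_ofReal ?_
  rw [cast_logRatio, cast_logRatio]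
  rcases lt_or_ge n 2 with hn | hn
  · interval_cases n <;> simp
  · have h1 : 1 ≤ Nat.log 2 (n ^ 2 ^ s) :=
      Nat.le_log_of_pow_le one_lt_two (by
        rw [pow_one]
        exact hn.trans (Nat.le_self_pow (by positivity) n))
    have h2 : (0 : ℝ) < Nat.log 2 (n ^ 2 ^ s) := by exact_mod_cast h1
    have h3 := monotone_dyadic_log hn hst
    beta_reduce at h3
    gcongr

theorem iInf_qval_logRatio (n : ℕ) :
    ⨅ s, qval (logRatio n s) = ENNReal.ofReal (n / Real.logb 2 n ^ 5) := by
  refine tendsto_nhds_unique (tendsto_atTop_iInf (antitone_qval_logRatio n)) ?_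
  refine ENNReal.tendsto_ofReal ?_
  simp only [cast_logRatio]
  rcases lt_or_ge n 2 with hn | hn
  · interval_cases n <;> simp
  · have : 0 < Real.logb 2 n := Real.logb_pos one_lt_two (by exact_mod_cast hn)
    exact tendsto_const_nhds.div ((tendsto_dyadic_log n).pow 5) (by positivity)

theorem exists_forall_one_le_div_logb_pow :
    ∃ n₀ : ℕ, 2 ≤ n₀ ∧ ∀ n : ℕ, n₀ ≤ n → 1 ≤ (n : ℝ) / Real.logb 2 n ^ 5 := by
  have h1 := (Real.isLittleO_pow_log_id_atTop (n := 5)).comp_tendsto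
    (tendsto_natCast_atTop_atTop (R := ℝ))
  have h2 : (0 : ℝ) < Real.log 2 ^ 5 := pow_pos (Real.log_pos one_lt_two) 5
  obtain ⟨n₀, hn₀⟩ := Filter.eventually_atTop.1 (h1.bound h2)
  refine ⟨max n₀ 2, le_max_right _ _, fun n hn => ?_⟩
  have h3 := hn₀ n ((le_max_left _ _).trans hn)
  have hn2 : 2 ≤ n := (le_max_right _ _).trans hn
  have h4 : 0 < Real.logb 2 n := Real.logb_pos one_lt_two (by exact_mod_cast hn2)
  have h5 : 0 < Real.log n := Real.log_pos (by exact_mod_cast hn2)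
  rw [one_le_div (by positivity), ← Real.log_div_log, div_pow, div_le_iff₀ h2, mul_comm]
  simpa [abs_of_pos h5] using h3

theorem Set.Finite.exists_computable_mem {α : Type*} [Primcodable α] {S : Set α}
    (hS : S.Finite) : ∃ b : α → Bool, Computable b ∧ ∀ x, b x = true ↔ x ∈ S := by
  induction S, hS using Set.Finite.induction_on with
  | empty => exact ⟨fun _ => false, Computable.const _, by simp⟩
  | @insert a S _ _ ih =>
    obtain ⟨b, hb, hbS⟩ := ih
    have he : Computable fun x : α => encode x := Computable.encode
    refine ⟨fun x => encode x == encode a || b x, by fun_prop, fun x => ?_⟩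
    simp [hbS]

theorem upperSemicomputable_of_flag {p : List Bool → Prop} [DecidablePred p] {n₀ : ℕ}
    (hn₀ : ∀ n : ℕ, n₀ ≤ n → 1 ≤ (n : ℝ) / Real.logb 2 n ^ 5) {flag : List Bool → ℕ → Bool}
    (hc : Computable fun q : List Bool × ℕ => flag q.1 q.2)
    (hp : ∀ x, p x ↔ ∀ s, flag x s = true)
    (hanti : ∀ x s t, s ≤ t → flag x t = true → flag x s = true)
    (hconst : ∀ x : List Bool, x.length < n₀ → ∀ s t, flag x s = true → flag x t = true) :
    UpperSemicomputable fun x =>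
      if p x then ENNReal.ofReal (x.length / Real.logb 2 x.length ^ 5) else 1 := by
  have hr : ∀ x : List Bool, n₀ ≤ x.length → ∀ s, 1 ≤ qval (logRatio x.length s) := by
    intro x hx s
    refine le_trans ?_ (iInf_le (fun s => qval (logRatio x.length s)) s)
    rw [iInf_qval_logRatio, ENNReal.one_le_ofReal]
    exact hn₀ _ hx
  have hval : ∀ x s, qtval (some (bif flag x s then logRatio x.length s else 1)) =
      if flag x s = true then qval (logRatio x.length s) else 1 := by
    intro x s
    cases flag x s <;> simp [qtval, qval]
  have hmono : ∀ x, Antitone fun s =>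
      qtval (some (bif flag x s then logRatio x.length s else 1)) := by
    intro x s t hst
    simp only [hval]
    by_cases ht : flag x t = true
    · rw [if_pos ht, if_pos (hanti x s t hst ht)]
      exact antitone_qval_logRatio _ hst
    · rw [if_neg ht]
      split_ifs with hs
      · exact hr x (not_lt.1 fun hlt => ht (hconst x hlt s t hs)) s
      · exact le_rfl
  refine ⟨fun x s => some (bif flag x s then logRatio x.length s else 1), ?_, ?_, hmono, ?_⟩
  · have h1 : Computable fun q : List Bool × ℕ => logRatio q.1.length q.2 :=
      (computable_logRatio.comp ((Computable.list_length.comp Computable.fst).pair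
        Computable.snd)).of_eq fun _ => rfl
    have h2 : Computable fun q : List Bool × ℕ =>
        bif flag q.1 q.2 then logRatio q.1.length q.2 else 1 :=
      Computable.cond hc h1 (Computable.const 1)
    exact (Computable.option_some.comp h2).of_eq fun _ => rfl
  · rintro x s a ⟨⟩
    cases flag x s
    · simp
    · exact logRatio_nonneg _ _
  · intro x
    simp only [hval]
    split_ifs with hx
    · rw [← iInf_qval_logRatio]
      exact iInf_congr fun s => (if_pos ((hp x).1 hx s)).symm
    · obtain ⟨s, hs⟩ := not_forall.1 (mt (hp x).2 hx)
      refine le_antisymm (le_iInf fun t => ?_) ((iInf_le _ s).trans_eq (if_neg hs))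
      split_ifs with ht
      · exact hr x (not_lt.1 fun hlt => hs (hconst x hlt t s ht)) t
      · exact le_rfl

theorem exists_flag_forall {p : List Bool → ℕ → Bool} {n₀ : ℕ} {q : List Bool → Prop}
    (hc : Computable fun a : List Bool × ℕ => p a.1 a.2)
    (hq : ∀ x : List Bool, n₀ ≤ x.length → (q x ↔ ∀ t, p x t = true)) :
    ∃ flag : List Bool → ℕ → Bool, Computable (fun a : List Bool × ℕ => flag a.1 a.2) ∧
      (∀ x, q x ↔ ∀ s, flag x s = true) ∧
      (∀ x s t, s ≤ t → flag x t = true → flag x s = true) ∧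
      ∀ x : List Bool, x.length < n₀ → ∀ s t, flag x s = true → flag x t = true := by
  obtain ⟨b, hb, hbS⟩ := ((List.finite_length_lt Bool n₀).subset
    (Set.sep_subset {x : List Bool | x.length < n₀} q)).exists_computable_mem
  let all : List Bool → ℕ → Bool := fun x s =>
    Nat.rec (motive := fun _ => Bool) true (fun t r => r && p x t) s
  have hall : ∀ x s, all x s = true ↔ ∀ t < s, p x t = true := by
    intro x s
    induction s with
    | zero => simp [all]
    | succ s ih =>
      have h : all x (s + 1) = (all x s && p x s) := rfl
      rw [h, Bool.and_eq_true, ih]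
      exact (Nat.forall_lt_succ_right (p := fun t => p x t = true)).symm
  have hallc : Computable fun a : List Bool × ℕ => all a.1 a.2 := by
    unfold all
    fun_prop
  have hlt : ∀ x : List Bool, ¬ n₀ ≤ x.length → Nat.ble n₀ x.length = false := fun x h =>
    Bool.eq_false_iff.2 fun h' => h (Nat.ble_eq.mp h')
  refine ⟨fun x s => bif Nat.ble n₀ x.length then all x s else b x, by fun_prop, fun x => ?_,
    fun x s t hst => ?_, fun x hx s t => ?_⟩
  · by_cases hx : n₀ ≤ x.length
    · simp only [Nat.ble_eq.mpr hx, cond_true, hall]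
      rw [hq x hx]
      exact ⟨fun h s t _ => h t, fun h t => h (t + 1) t (Nat.lt_succ_self t)⟩
    · simp only [hlt x hx, cond_false, hbS]
      simp [not_le.1 hx]
  · beta_reduce
    cases Nat.ble n₀ x.length
    · exact id
    · simp only [cond_true, hall]
      exact fun h k hk => h k (hk.trans_le hst)
  · simp only [hlt x (not_le.2 hx), cond_false]
    exact id

theorem upperSemicomputable_etest {m : List Bool → ℝ≥0∞} {mt : List Bool → ℕ → ℚ}
    (hmt : IsApproxFromBelow m mt) {f : ℕ → ℕ} (hf : Computable f) {g : List Bool × ℕ → ℕ}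
    (hg : Computable g) : UpperSemicomputable (etest mt f g) := by
  obtain ⟨n₀, hn2, hn₀⟩ := exists_forall_one_le_div_logb_pow
  obtain ⟨a, b, ha, hb, hab⟩ := hmt.ratComputable.comp (k := fun t => (zeros t, f t))
    (computable_zeros.pair hf)
  have hl : RatComputable fun q : List Bool × ℕ => ((2 : ℕ) : ℚ) * mt q.1 q.2 :=
    (RatComputable.natCast (Computable.const 2)).mul hmt.ratComputable
  have hr : RatComputable fun q : List Bool × ℕ => mt q.1 (g q) :=
    hmt.ratComputable.comp (k := fun q => (q.1, g q)) (Computable.fst.pair hg)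
  obtain ⟨d, hd, hdeq⟩ := hl.exists_decide_le hr
  have hp : Computable fun q : List Bool × ℕ =>
      Nat.ble (2 ^ (a q.2 * q.1.length)) (q.1.length ^ (6 * b q.2)) || d (q.1, q.2) := by
    fun_prop
  obtain ⟨flag, hflag, h1, h2, h3⟩ := exists_flag_forall (n₀ := n₀) (q := EtestCond mt f g)
    (p := fun x t => Nat.ble (2 ^ (a t * x.length)) (x.length ^ (6 * b t)) || d (x, t)) hp
    fun x hx => forall_congr' fun t => by
      have hn : 0 < x.length := by omega
      have hnR : (0 : ℝ) < x.length := by exact_mod_cast hn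
      have hbR : (0 : ℝ) < b t := by exact_mod_cast (hab t).1
      have hlog : 0 ≤ Real.logb 2 x.length :=
        (Nat.cast_nonneg _).trans (log_le_logb_two x.length)
      rw [Bool.or_eq_true, Nat.ble_eq, hdeq (x, t)]
      refine or_congr ?_ ?_
      · have hq : ((mt (zeros t) (f t) : ℚ) : ℝ) = a t / b t := by
          have := (hab t).2
          simp only at this
          rw [this]
          push_cast
          rfl
        rw [qval, ENNReal.ofReal_le_ofReal_iff (by positivity), hq, div_le_div_iff₀ hbR hnR]
        have hpow : (2 : ℕ) ^ (a t * x.length) ≤ x.length ^ (6 * b t) ↔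
            Real.logb 2 ((2 : ℝ) ^ (a t * x.length)) ≤
              Real.logb 2 ((x.length : ℝ) ^ (6 * b t)) := by
          rw [Real.logb_le_logb one_lt_two (by positivity) (by positivity)]
          exact_mod_cast Iff.rfl
        rw [hpow, Real.logb_pow, Real.logb_pow, Real.logb_self_eq_one one_lt_two]
        push_cast
        rw [mul_one, mul_right_comm]
      · rw [← qval_le_qval_iff (hmt.2.1 _ _), qval_mul (Nat.cast_nonneg _), qval_natCast]
        simp
  classical
  have h := upperSemicomputable_of_flag hn₀ hflag h1 h2 h3
  convert h using 2 with x
  unfold etest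
  congr

end Computability

/-- Proposition 1: for some constant `c > 0` and some computable `f`, for every computable `g`
the function `c · e_{f,g}` is an upper semicomputable sumtest for `m`; in particular `e_{f,g}`
is upper semicomputable and `∑' x, m(x) e_{f,g}(x) ≤ 1/c`. -/
theorem scaled_etest_is_upper_semicomputable_sumtest
    (m : List Bool → ℝ≥0∞) (mt : List Bool → ℕ → ℚ)
    (hm : IsUniversalSemimeasure m) (hmt : IsApproxFromBelow m mt) :
    ∃ c : ℝ≥0, 0 < c ∧ ∃ f : ℕ → ℕ, Computable f ∧
      ∀ g : List Bool × ℕ → ℕ, Computable g →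
        UpperSemicomputable (fun x => (c : ℝ≥0∞) * etest mt f g x) ∧
        IsSumtest m (fun x => (c : ℝ≥0∞) * etest mt f g x) ∧
        UpperSemicomputable (etest mt f g) ∧
        ∑' x : List Bool, m x * etest mt f g x ≤ 1 / (c : ℝ≥0∞) := by
  obtain ⟨K, f, hK, hf, hgap⟩ := hm.exists_simple_settling_times hmt
  obtain ⟨N, hN, hsum⟩ := exists_tsum_mul_etest_le hm.1 hmt hK hgap
  have hN0 : (N : ℝ≥0) ≠ 0 := by exact_mod_cast hN.ne'
  have hc : (((N : ℝ≥0)⁻¹ : ℝ≥0) : ℝ≥0∞) = (N : ℝ≥0∞)⁻¹ := by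
    rw [ENNReal.coe_inv hN0, ENNReal.coe_natCast]
  refine ⟨(N : ℝ≥0)⁻¹, by positivity, f, hf, fun g hg => ?_⟩
  have he := upperSemicomputable_etest hmt hf hg
  refine ⟨he.inv_natCast_mul hN, ?_, he, ?_⟩
  · rw [IsSumtest, hc]
    simp only [mul_left_comm (m _)]
    rw [ENNReal.tsum_mul_left, mul_comm, ← div_eq_mul_inv]
    exact ENNReal.div_le_of_le_mul (by simpa using hsum g)
  · rw [hc, one_div, inv_inv]
    exact hsum g
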